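/- arXiv:1910.08701 — 3 statements merged into one kernel-verified Lean document; each statement's English description precedes it below -/
import Mathlib

section
/- Assume λ_N^W > 0, let 0 < α ≤ λ_N^W/L and β = (1−√(αμ))/(1+√(αμ)). Then for every k ≥ 0 the D-ASG iterates satisfy E[‖x^{(k)} − x^∞‖²] ≤ 2(1−√(αμ))^k V_{S,α}(ξ₀)/μ + (σ²N√α/(μ√μ))·(2 − λ_N^W + αL). -/
open MeasureTheory Filter Real ProbabilityTheory
open scoped RealInnerProductSpace ENNReal NNReal Matrix

/-- The penalized objective `F_{W,α}(x) = (1/(2α)) xᵀ(I−𝒲)x + F(x)`. -/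
noncomputable def penObj {N d : ℕ} (W : Matrix (Fin N) (Fin N) ℝ) (α : ℝ)
    (f : Fin N → EuclideanSpace ℝ (Fin d) → ℝ)
    (x : PiLp 2 (fun _ : Fin N => EuclideanSpace ℝ (Fin d))) : ℝ :=
  1 / (2 * α) * ((∑ i, ‖x i‖ ^ 2) - ∑ i, ∑ j, W i j * ⟪x i, x j⟫) + ∑ i, f i (x i)

/-- The Lyapunov function `V_{S,α}(ξ) = ξᵀS_αξ + F_{W,α}(Tξ+x^∞) − F_{W,α}(x^∞)` with
`S_α = (vvᵀ) ⊗ I_{Nd}`, `v = (√(1/(2α)), √(μ/2) − √(1/(2α)))ᵀ`, written for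
`ξ = (a, b) ∈ ℝ^{Nd} × ℝ^{Nd}` (so that `ξᵀS_αξ = ‖v₁a + v₂b‖²`). -/
noncomputable def lyapS {N d : ℕ} (W : Matrix (Fin N) (Fin N) ℝ) (α μ : ℝ)
    (f : Fin N → EuclideanSpace ℝ (Fin d) → ℝ)
    (xinf a b : PiLp 2 (fun _ : Fin N => EuclideanSpace ℝ (Fin d))) : ℝ :=
  ‖Real.sqrt (1 / (2 * α)) • a + (Real.sqrt (μ / 2) - Real.sqrt (1 / (2 * α))) • b‖ ^ 2 +
    penObj W α f (a + xinf) - penObj W α f xinf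

/-- First-order lower bound for strongly convex differentiable functions. -/
theorem strongConvex_gradient_lower_bound {H : Type*} [NormedAddCommGroup H]
    [InnerProductSpace ℝ H] [CompleteSpace H] {μ : ℝ} {f : H → ℝ} {g y : H}
    (hg : HasGradientAt f g y)
    (hconv : ConvexOn ℝ Set.univ (fun x => f x - μ / 2 * ‖x‖ ^ 2)) (z : H) :
    f y + ⟪g, z - y⟫ + μ / 2 * ‖z - y‖ ^ 2 ≤ f z := by
  have hline : HasDerivAt (fun t : ℝ => y + t • (z - y)) (z - y) 0 := by
    simpa using ((hasDerivAt_id (0 : ℝ)).smul_const (z - y)).const_add y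
  have hg' : HasFDerivAt f (InnerProductSpace.toDual ℝ H g) (y + (0 : ℝ) • (z - y)) := by
    simpa using hg.hasFDerivAt
  have h1 := hg'.comp_hasDerivAt (0 : ℝ) hline
  have h2 := hline.norm_sq
  have h3 := h1.sub (h2.const_mul (μ / 2))
  have hc : ConvexOn ℝ Set.univ
      (fun t : ℝ => f (y + t • (z - y)) - μ / 2 * ‖y + t • (z - y)‖ ^ 2) := by
    have := hconv.comp_affineMap (AffineMap.lineMap y z : ℝ →ᵃ[ℝ] H)
    simpa [Function.comp_def, AffineMap.lineMap_apply, add_comm] using this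
  have h4 := hc.le_slope_of_hasDerivAt (Set.mem_univ 0) (Set.mem_univ 1) one_pos h3
  simp only [slope_def_field, InnerProductSpace.toDual_apply_apply, zero_smul, add_zero, one_smul,
    add_sub_cancel, sub_zero, div_one] at h4
  have h5 : ‖z‖ ^ 2 = ‖y‖ ^ 2 + 2 * ⟪y, z - y⟫ + ‖z - y‖ ^ 2 := by
    rw [← norm_add_sq_real, add_sub_cancel]
  rw [h5] at h4
  linarith

/-- Descent lemma for functions with a Lipschitz gradient. -/
theorem lipschitz_gradient_upper_bound {H : Type*} [NormedAddCommGroup H]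
    [InnerProductSpace ℝ H] [CompleteSpace H] {K : ℝ≥0} {f : H → ℝ} {g : H → H}
    (hg : ∀ x, HasGradientAt f (g x) x) (hlip : LipschitzWith K g) (y z : H) :
    f z ≤ f y + ⟪g y, z - y⟫ + K / 2 * ‖z - y‖ ^ 2 := by
  have hline (t : ℝ) : HasDerivAt (fun t : ℝ => y + t • (z - y)) (z - y) t := by
    simpa using ((hasDerivAt_id t).smul_const (z - y)).const_add y
  have h1 (t : ℝ) := (hg (y + t • (z - y))).hasFDerivAt.comp_hasDerivAt t (hline t)
  have h2 (t : ℝ) := ((h1 t).sub ((hasDerivAt_id t).mul_const ⟪g y, z - y⟫)).sub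
    (((hasDerivAt_id t).pow 2).const_mul (K / 2 * ‖z - y‖ ^ 2))
  have hanti := antitoneOn_of_hasDerivWithinAt_nonpos (convex_Ici (0 : ℝ))
    (fun t _ => (h2 t).continuousAt.continuousWithinAt)
    (fun t _ => (h2 t).hasDerivWithinAt) (fun t ht => by
      rw [interior_Ici, Set.mem_Ioi] at ht
      have h3 : ⟪g (y + t • (z - y)) - g y, z - y⟫ ≤ K * t * ‖z - y‖ ^ 2 := by
        refine (real_inner_le_norm _ _).trans ?_
        have := hlip.norm_sub_le (y + t • (z - y)) y
        rw [add_sub_cancel_left, norm_smul, Real.norm_of_nonneg ht.le] at this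
        nlinarith [norm_nonneg (z - y)]
      rw [inner_sub_left] at h3
      simp only [InnerProductSpace.toDual_apply_apply, id_eq]
      norm_num
      linarith)
  have h4 := hanti (Set.mem_Ici.2 le_rfl) (Set.mem_Ici.2 zero_le_one) zero_le_one
  simp at h4
  linarith

/-- One-step decay of the Nesterov Lyapunov function, for a fixed noise realization `w`. -/
theorem nesterov_lyapunov_step {H : Type*} [NormedAddCommGroup H] [InnerProductSpace ℝ H]
    {μ α β p M : ℝ} {G : H → ℝ} {g : H → H}
    (hα : 0 < α) (hp0 : 0 ≤ p) (hp1 : p ≤ 1) (hp : p ^ 2 = α * μ)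
    (hβ : β * (1 + p) = 1 - p) (hM : M ≤ 1)
    (hlow : ∀ y z, G y + ⟪g y, z - y⟫ + μ / 2 * ‖z - y‖ ^ 2 ≤ G z)
    (hup : ∀ y z, G z ≤ G y + ⟪g y, z - y⟫ + M / (2 * α) * ‖z - y‖ ^ 2)
    (s x x' y w : H) (hy : y = (1 + β) • x - β • x') :
    1 / (2 * α) * ‖(y - α • g y - α • w - s) - (1 - p) • (x - s)‖ ^ 2
        + (G (y - α • g y - α • w) - G s) ≤
      (1 - p) * (1 / (2 * α) * ‖(x - s) - (1 - p) • (x' - s)‖ ^ 2 + (G x - G s))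
        + ⟪(M * α) • g y - ((y - s) - (1 - p) • (x - s)), w⟫
        + α / 2 * (1 + M) * ‖w‖ ^ 2 := by
  obtain ⟨r, hr⟩ : ∃ r, r * α = 1 := ⟨α⁻¹, inv_mul_cancel₀ hα.ne'⟩
  have hr0 : 0 ≤ r := by nlinarith
  have hμ : μ = p ^ 2 * r := by rw [hp]; linear_combination -μ * hr
  have hr2 : 1 / (2 * α) = r / 2 := by field_simp; linarith
  have hMr : M / (2 * α) = M * r / 2 := by field_simp; linear_combination -M * hr
  have hβ0 : 0 ≤ β := by nlinarith
  rw [hr2]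
  simp only [hMr, hμ] at hlow hup
  have h1 := hlow y x
  have h2 := hlow y s
  have h3 := hup y (y - α • g y - α • w)
  set A := x - s with hA
  set D := x - x' with hD
  set c := g y with hc
  rw [show x - y = -β • D by rw [hy, hD]; module] at h1
  rw [show s - y = -A - β • D by rw [hy, hA, hD]; module] at h2
  rw [show y - α • c - α • w - y = -α • c - α • w by module] at h3
  rw [show (y - α • c - α • w - s) - (1 - p) • A = p • A + β • D - α • c - α • w by
    rw [hy, hA, hD]; module]
  rw [show A - (1 - p) • (x' - s) = p • A + (1 - p) • D by rw [hA, hD]; module]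
  rw [show (y - s) - (1 - p) • A = p • A + β • D by rw [hy, hA, hD]; module]
  simp only [← real_inner_self_eq_norm_sq, inner_add_left, inner_add_right, inner_sub_left,
    inner_sub_right, real_inner_smul_left, real_inner_smul_right, inner_neg_left,
    inner_neg_right] at h1 h2 h3 ⊢
  rw [real_inner_comm A D, real_inner_comm A c, real_inner_comm D c, real_inner_comm c w,
    real_inner_comm A w, real_inner_comm D w] at *
  have hcc := mul_le_mul_of_nonneg_left hM (mul_nonneg hα.le (real_inner_self_nonneg (x := c)))
  have hDD := real_inner_self_nonneg (x := D)
  have hDD' : 0 ≤ r / 2 * ((1 - p) ^ 2 * β * p) * ⟪D, D⟫ := by positivity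
  generalize ⟪A, A⟫ = AA at *
  generalize ⟪A, D⟫ = AD at *
  generalize ⟪D, D⟫ = DD at *
  generalize ⟪A, c⟫ = AC at *
  generalize ⟪D, c⟫ = DC at *
  generalize ⟪A, w⟫ = AW at *
  generalize ⟪D, w⟫ = DW at *
  generalize ⟪c, c⟫ = CC at *
  generalize ⟪c, w⟫ = CW at *
  generalize ⟪w, w⟫ = WW at *
  linear_combination (1 - p) * h1 + p * h2 + h3 + hcc / 2 + hDD'
    + (M * α / 2 * (CC + 2 * CW + WW) - (p * AC + β * DC + p * AW + β * DW)
      + α / 2 * (CC + 2 * CW + WW)) * hr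
    + (r * p * (1 - p) * AD + r / 2 * ((1 - p) ^ 2 + β * (1 - p)) * DD) * hβ

/-- A centered noise is orthogonal in mean to square-integrable past-measurable vectors. -/
theorem integral_inner_eq_zero_of_condExp_eq_zero {H : Type*} [NormedAddCommGroup H]
    [InnerProductSpace ℝ H] [CompleteSpace H] {Ω : Type*} {m mΩ : MeasurableSpace Ω}
    {P : Measure Ω} [IsFiniteMeasure P] (hm : m ≤ mΩ) {c w : Ω → H}
    (hc : StronglyMeasurable[m] c) (hw : Integrable w P)
    (hcw : Integrable (fun ω => ⟪c ω, w ω⟫) P) (hmean : P[w|m] =ᵐ[P] 0) :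
    ∫ ω, ⟪c ω, w ω⟫ ∂P = 0 := by
  have h : P[fun ω => ⟪c ω, w ω⟫|m] =ᵐ[P] fun ω => ⟪c ω, (P[w|m]) ω⟫ :=
    condExp_bilin_of_stronglyMeasurable_left (innerSL ℝ (E := H)) hc hcw hw
  rw [← integral_condExp hm]
  refine integral_eq_zero_of_ae ?_
  filter_upwards [h, hmean] with ω h1 h2
  simp [h1, h2]

/-- Square-integrable vectors have integrable inner product. -/
theorem integrable_real_inner_of_memLp {H : Type*} [NormedAddCommGroup H]
    [InnerProductSpace ℝ H] {Ω : Type*} {mΩ : MeasurableSpace Ω}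
    {P : Measure Ω} {c w : Ω → H} (hc : MemLp c 2 P) (hw : MemLp w 2 P) :
    Integrable (fun ω => ⟪c ω, w ω⟫) P :=
  memLp_one_iff_integrable.1 ((innerSL ℝ (E := H)).memLp_of_bilin 1 hc hw)

/-- Expected Lyapunov bound for the stochastic Nesterov method. -/
theorem nesterov_expected_sq_dist_le {H : Type*} [NormedAddCommGroup H] [InnerProductSpace ℝ H]
    [CompleteSpace H]
    {μ α β p M S : ℝ} {G : H → ℝ} {g : H → H}
    (hα : 0 < α) (hμ : 0 < μ) (hp0 : 0 < p) (hp1 : p ≤ 1) (hp : p ^ 2 = α * μ)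
    (hβ : β * (1 + p) = 1 - p) (hM0 : 0 ≤ M) (hM : M ≤ 1) (hS : 0 ≤ S)
    (hlow : ∀ y z, G y + ⟪g y, z - y⟫ + μ / 2 * ‖z - y‖ ^ 2 ≤ G z)
    (hup : ∀ y z, G z ≤ G y + ⟪g y, z - y⟫ + M / (2 * α) * ‖z - y‖ ^ 2)
    (hGc : Continuous G) (hgc : Continuous g) (s : H) (hs : g s = 0)
    {Ω : Type*} {mΩ : MeasurableSpace Ω} (P : Measure Ω) [IsProbabilityMeasure P]
    (ℱ : ℕ → MeasurableSpace Ω) (hℱ : ∀ k, ℱ k ≤ mΩ) (hℱmono : Monotone ℱ)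
    (X X' w : ℕ → Ω → H) (x0 xm1 : H)
    (hX0 : ∀ ω, X 0 ω = x0) (hX'0 : ∀ ω, X' 0 ω = xm1) (hX' : ∀ k, X' (k + 1) = X k)
    (hXadapted : ∀ k, StronglyMeasurable[ℱ k] (X k))
    (hwmeas : ∀ k, StronglyMeasurable[ℱ (k + 1)] (w (k + 1)))
    (hrec : ∀ k ω, X (k + 1) ω = ((1 + β) • X k ω - β • X' k ω)
      - α • g ((1 + β) • X k ω - β • X' k ω) - α • w (k + 1) ω)
    (hwmean : ∀ k, P[w (k + 1)|ℱ k] =ᵐ[P] 0)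
    (hwL2 : ∀ k, Integrable (fun ω => ‖w (k + 1) ω‖ ^ 2) P)
    (hwvar : ∀ k, ∀ᵐ ω ∂P, (P[fun ω' => ‖w (k + 1) ω'‖ ^ 2|ℱ k]) ω ≤ S) (k : ℕ) :
    μ / 2 * ∫ ω, ‖X k ω - s‖ ^ 2 ∂P ≤
      (1 - p) ^ k * (1 / (2 * α) * ‖(x0 - s) - (1 - p) • (xm1 - s)‖ ^ 2 + (G x0 - G s))
        + α / 2 * (1 + M) * S / p := by
  have hGs (z : H) : μ / 2 * ‖z - s‖ ^ 2 ≤ G z - G s := by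
    have := hlow s z
    rw [hs, inner_zero_left] at this
    linarith
  have hGs0 (z : H) : 0 ≤ G z - G s := (by positivity : 0 ≤ μ / 2 * ‖z - s‖ ^ 2).trans (hGs z)
  have hGs' (z : H) : G z - G s ≤ M / (2 * α) * ‖z - s‖ ^ 2 := by
    have := hup s z
    rw [hs, inner_zero_left] at this
    linarith
  have hgbound (z : H) : ‖g z‖ ≤ 1 / α * ‖z - s‖ := by
    have h1 := hup z (z - α • g z)
    rw [show z - α • g z - z = -(α • g z) by abel, inner_neg_right, real_inner_smul_right,
      real_inner_self_eq_norm_sq, norm_neg, norm_smul, Real.norm_of_nonneg hα.le] at h1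
    have h2 := hGs0 (z - α • g z)
    have h3 := hGs' z
    have h4 : M / (2 * α) * (α * ‖g z‖) ^ 2 ≤ α / 2 * ‖g z‖ ^ 2 := by
      rw [show M / (2 * α) * (α * ‖g z‖) ^ 2 = M * (α / 2 * ‖g z‖ ^ 2) by field_simp]
      exact mul_le_of_le_one_left (by positivity) hM
    have h5 : M / (2 * α) * ‖z - s‖ ^ 2 ≤ 1 / (2 * α) * ‖z - s‖ ^ 2 := by gcongr
    have h6 : (α * ‖g z‖) ^ 2 ≤ ‖z - s‖ ^ 2 := by
      have h7 : α / 2 * ‖g z‖ ^ 2 ≤ 1 / (2 * α) * ‖z - s‖ ^ 2 := by linarith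
      have h8 := mul_le_mul_of_nonneg_left h7 (by positivity : 0 ≤ 2 * α)
      rw [show 2 * α * (1 / (2 * α) * ‖z - s‖ ^ 2) = ‖z - s‖ ^ 2 by field_simp] at h8
      linarith
    have h9 := abs_le_of_sq_le_sq' h6 (norm_nonneg _)
    rw [one_div, ← div_eq_inv_mul, le_div_iff₀ hα]
    linarith [h9.2]
  have hX'ad : ∀ k, StronglyMeasurable[ℱ k] (X' k) := by
    rintro (_ | k)
    · rw [show X' 0 = fun _ => xm1 from funext hX'0]
      exact stronglyMeasurable_const
    · rw [hX']
      exact (hXadapted k).mono (hℱmono k.le_succ)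
  set Y : ℕ → Ω → H := fun k ω => (1 + β) • X k ω - β • X' k ω with hY
  have hYad (k : ℕ) : StronglyMeasurable[ℱ k] (Y k) :=
    ((hXadapted k).const_smul _).sub ((hX'ad k).const_smul _)
  have hwLp (k : ℕ) : MemLp (w (k + 1)) 2 P :=
    (memLp_two_iff_integrable_sq_norm
      ((hwmeas k).mono (hℱ (k + 1))).aestronglyMeasurable).2 (hwL2 k)
  have hgLp (k : ℕ) (h : MemLp (fun ω => Y k ω - s) 2 P) : MemLp (fun ω => g (Y k ω)) 2 P :=
    h.of_le_mul (hgc.comp_stronglyMeasurable ((hYad k).mono (hℱ k))).aestronglyMeasurable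
      (Eventually.of_forall fun ω => hgbound _)
  have hYLp' (k : ℕ) (h : MemLp (fun ω => X k ω - s) 2 P)
      (h' : MemLp (fun ω => X' k ω - s) 2 P) : MemLp (fun ω => Y k ω - s) 2 P := by
    convert! (h.const_smul (1 + β)).sub (h'.const_smul β) using 1
    funext ω
    simp only [hY, Pi.sub_apply, Pi.smul_apply]
    module
  have hLp : ∀ k, MemLp (fun ω => X k ω - s) 2 P ∧ MemLp (fun ω => X' k ω - s) 2 P := by
    intro k
    induction k with
    | zero => simp only [hX0, hX'0]; exact ⟨memLp_const _, memLp_const _⟩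
    | succ k ih =>
      refine ⟨?_, by rw [hX']; exact ih.1⟩
      have hYk := hYLp' k ih.1 ih.2
      convert! (hYk.sub ((hgLp k hYk).const_smul α)).sub ((hwLp k).const_smul α) using 1
      funext ω
      simp only [hrec, Pi.sub_apply, Pi.smul_apply, hY]
      abel
  have hYLp (k : ℕ) : MemLp (fun ω => Y k ω - s) 2 P := hYLp' k (hLp k).1 (hLp k).2
  have hXsq (k : ℕ) : Integrable (fun ω => ‖X k ω - s‖ ^ 2) P :=
    (hLp k).1.integrable_norm_pow two_ne_zero
  have hGint (k : ℕ) : Integrable (fun ω => G (X k ω) - G s) P := by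
    refine ((hXsq k).const_mul (M / (2 * α))).mono'
      (hGc.comp_stronglyMeasurable ((hXadapted k).mono (hℱ k))
        |>.sub stronglyMeasurable_const).aestronglyMeasurable (Eventually.of_forall fun ω => ?_)
    rw [Real.norm_of_nonneg (hGs0 _)]
    exact hGs' _
  set v : ℕ → Ω → ℝ := fun k ω =>
    1 / (2 * α) * ‖(X k ω - s) - (1 - p) • (X' k ω - s)‖ ^ 2 + (G (X k ω) - G s) with hv
  have hvint (k : ℕ) : Integrable (v k) P :=
    ((((hLp k).1.sub ((hLp k).2.const_smul (1 - p))).integrable_norm_pow two_ne_zero).const_mul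
      (1 / (2 * α))).add (hGint k)
  have hwsq (k : ℕ) : ∫ ω, ‖w (k + 1) ω‖ ^ 2 ∂P ≤ S := by
    rw [← integral_condExp (hℱ k)]
    simpa using integral_mono_ae integrable_condExp (integrable_const S) (hwvar k)
  have hstep (k : ℕ) : ∫ ω, v (k + 1) ω ∂P ≤ (1 - p) * ∫ ω, v k ω ∂P + α / 2 * (1 + M) * S := by
    set c : Ω → H := fun ω =>
      (M * α) • g (Y k ω) - ((Y k ω - s) - (1 - p) • (X k ω - s)) with hc
    have hcLp : MemLp c 2 P :=
      ((hgLp k (hYLp k)).const_smul (M * α)).sub ((hYLp k).sub ((hLp k).1.const_smul (1 - p)))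
    have hcm : StronglyMeasurable[ℱ k] c :=
      ((hgc.comp_stronglyMeasurable (hYad k)).const_smul (M * α)).sub
        (((hYad k).sub stronglyMeasurable_const).sub
          (((hXadapted k).sub stronglyMeasurable_const).const_smul (1 - p)))
    have hcw := integrable_real_inner_of_memLp hcLp (hwLp k)
    have hzero := integral_inner_eq_zero_of_condExp_eq_zero (hℱ k) hcm
      ((hwLp k).integrable one_le_two) hcw (hwmean k)
    have hvc : Integrable (fun ω => (1 - p) * v k ω + ⟪c ω, w (k + 1) ω⟫) P :=
      ((hvint k).const_mul _).add hcw
    have hpt (ω : Ω) : v (k + 1) ω ≤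
        (1 - p) * v k ω + ⟪c ω, w (k + 1) ω⟫ + α / 2 * (1 + M) * ‖w (k + 1) ω‖ ^ 2 := by
      simp only [hv, hrec, hX']
      exact nesterov_lyapunov_step hα hp0.le hp1 hp hβ hM hlow hup s (X k ω) (X' k ω) _ _ rfl
    calc ∫ ω, v (k + 1) ω ∂P
        ≤ ∫ ω, ((1 - p) * v k ω + ⟪c ω, w (k + 1) ω⟫
            + α / 2 * (1 + M) * ‖w (k + 1) ω‖ ^ 2) ∂P :=
          integral_mono (hvint _) (hvc.add ((hwL2 k).const_mul _)) hpt
      _ = (1 - p) * ∫ ω, v k ω ∂P + α / 2 * (1 + M) * ∫ ω, ‖w (k + 1) ω‖ ^ 2 ∂P := by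
          rw [integral_add hvc ((hwL2 k).const_mul _),
            integral_add ((hvint k).const_mul _) hcw, integral_const_mul, integral_const_mul,
            hzero, add_zero]
      _ ≤ _ := by gcongr; exact hwsq k
  have hbound : ∫ ω, v k ω ∂P ≤
      (1 - p) ^ k * (1 / (2 * α) * ‖(x0 - s) - (1 - p) • (xm1 - s)‖ ^ 2 + (G x0 - G s))
        + α / 2 * (1 + M) * S / p := by
    induction k with
    | zero =>
      simp only [hv, hX0, hX'0]
      simp
      positivity
    | succ k ih =>
      refine (hstep k).trans ((add_le_add_left
        (mul_le_mul_of_nonneg_left ih (sub_nonneg.2 hp1)) _).trans_eq ?_)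
      field_simp
      ring
  refine le_trans ?_ hbound
  rw [← integral_const_mul]
  refine integral_mono ((hXsq k).const_mul _) (hvint k) fun ω => ?_
  have h1 := hGs (X k ω)
  have h2 : 0 ≤ 1 / (2 * α) * ‖(X k ω - s) - (1 - p) • (X' k ω - s)‖ ^ 2 := by positivity
  simp only [hv]
  linarith

/-- Spectral form of the quadratic form of a mixing matrix acting on blocks. -/
theorem sum_inner_eq_sum_mul_norm_sq {n : Type*} [Fintype n] [DecidableEq n] {E : Type*}
    [NormedAddCommGroup E] [InnerProductSpace ℝ E] {W V : Matrix n n ℝ} {lam : n → ℝ}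
    (hW : W = Vᵀ * Matrix.diagonal lam * V) (x : n → E) :
    ∑ i, ∑ j, W i j * ⟪x i, x j⟫ = ∑ l, lam l * ‖∑ j, V l j • x j‖ ^ 2 := by
  have hWij (i j : n) : W i j = ∑ l, V l i * lam l * V l j := by
    simp [hW, Matrix.mul_apply, Matrix.diagonal_apply]
  simp_rw [hWij, ← real_inner_self_eq_norm_sq, sum_inner, inner_sum, real_inner_smul_left,
    real_inner_smul_right, Finset.sum_mul, Finset.mul_sum]
  rw [Finset.sum_comm_cycle]
  refine Finset.sum_congr rfl fun l _ => ?_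
  refine Finset.sum_congr rfl fun i _ => Finset.sum_congr rfl fun j _ => ?_
  ring

/-- The quadratic form of `I - W` lies between `0` and `1 - c` when the spectrum of `W` lies in
`[c, 1]`. -/
theorem sum_norm_sq_sub_sum_inner_bounds {n : Type*} [Fintype n] [DecidableEq n] {E : Type*}
    [NormedAddCommGroup E] [InnerProductSpace ℝ E] {W V : Matrix n n ℝ} {lam : n → ℝ} {c : ℝ}
    (hV : V * Vᵀ = 1) (hW : W = Vᵀ * Matrix.diagonal lam * V) (hle : ∀ l, lam l ≤ 1)
    (hge : ∀ l, c ≤ lam l) (x : n → E) :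
    0 ≤ ∑ i, ‖x i‖ ^ 2 - ∑ i, ∑ j, W i j * ⟪x i, x j⟫ ∧
      ∑ i, ‖x i‖ ^ 2 - ∑ i, ∑ j, W i j * ⟪x i, x j⟫ ≤ (1 - c) * ∑ i, ‖x i‖ ^ 2 := by
  have hone : (1 : Matrix n n ℝ) = Vᵀ * Matrix.diagonal (fun _ => 1) * V := by
    rw [Matrix.diagonal_one, mul_one, mul_eq_one_comm.1 hV]
  have h1 := sum_inner_eq_sum_mul_norm_sq hone x
  simp only [Matrix.one_apply, ite_mul, one_mul, zero_mul, Finset.sum_ite_eq, Finset.mem_univ,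
    if_true, real_inner_self_eq_norm_sq] at h1
  rw [sum_inner_eq_sum_mul_norm_sq hW, h1, ← Finset.sum_sub_distrib, Finset.mul_sum]
  constructor
  · refine Finset.sum_nonneg fun l _ => ?_
    nlinarith [hle l, sq_nonneg ‖∑ j, V l j • x j‖]
  · refine Finset.sum_le_sum fun l _ => ?_
    nlinarith [hge l, sq_nonneg ‖∑ j, V l j • x j‖]

/-- Second-order expansion of the quadratic form of `I - W`. -/
theorem sum_norm_sq_sub_sum_inner_add {n : Type*} [Fintype n] {E : Type*}
    [NormedAddCommGroup E] [InnerProductSpace ℝ E] {W : Matrix n n ℝ} (hW : W.IsSymm)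
    (y h : n → E) :
    ∑ i, ‖y i + h i‖ ^ 2 - ∑ i, ∑ j, W i j * ⟪y i + h i, y j + h j⟫ =
      (∑ i, ‖y i‖ ^ 2 - ∑ i, ∑ j, W i j * ⟪y i, y j⟫)
        + 2 * ∑ i, ⟪y i - ∑ j, W i j • y j, h i⟫
        + (∑ i, ‖h i‖ ^ 2 - ∑ i, ∑ j, W i j * ⟪h i, h j⟫) := by
  have h1 : ∑ i, ∑ j, W i j * ⟪y i, h j⟫ = ∑ i, ∑ j, W i j * ⟪y j, h i⟫ := by
    rw [Finset.sum_comm]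
    simp_rw [fun i j => hW.apply i j]
  have h2 : ∑ i, ∑ j, W i j * ⟪h i, y j⟫ = ∑ i, ∑ j, W i j * ⟪y j, h i⟫ := by
    simp_rw [real_inner_comm]
  simp_rw [norm_add_sq_real, inner_sub_left, sum_inner, real_inner_smul_left, inner_add_left,
    inner_add_right, mul_add, Finset.sum_add_distrib, Finset.sum_sub_distrib, ← Finset.mul_sum]
  linarith

/-- The gradient of the penalized objective. -/
noncomputable def penGrad {N d : ℕ} (W : Matrix (Fin N) (Fin N) ℝ) (α : ℝ)
    (gradf : Fin N → EuclideanSpace ℝ (Fin d) → EuclideanSpace ℝ (Fin d))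
    (x : PiLp 2 (fun _ : Fin N => EuclideanSpace ℝ (Fin d))) :
    PiLp 2 (fun _ : Fin N => EuclideanSpace ℝ (Fin d)) :=
  WithLp.toLp 2 fun i => α⁻¹ • (x i - ∑ j, W i j • x j) + gradf i (x i)

/-- The penalized objective as its linearization plus quadratic and Bregman remainders. -/
theorem penObj_eq {N d : ℕ} {W : Matrix (Fin N) (Fin N) ℝ} (hW : W.IsSymm) (α : ℝ)
    (f : Fin N → EuclideanSpace ℝ (Fin d) → ℝ)
    (gradf : Fin N → EuclideanSpace ℝ (Fin d) → EuclideanSpace ℝ (Fin d))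
    (y z : PiLp 2 (fun _ : Fin N => EuclideanSpace ℝ (Fin d))) :
    penObj W α f z = penObj W α f y + ⟪penGrad W α gradf y, z - y⟫
      + 1 / (2 * α) * (∑ i, ‖(z - y) i‖ ^ 2 - ∑ i, ∑ j, W i j * ⟪(z - y) i, (z - y) j⟫)
      + ∑ i, (f i (z i) - f i (y i) - ⟪gradf i (y i), (z - y) i⟫) := by
  have h := sum_norm_sq_sub_sum_inner_add hW (fun i => y i) (fun i => (z - y) i)
  have hin : ⟪penGrad W α gradf y, z - y⟫ =
      α⁻¹ * ∑ i, ⟪y i - ∑ j, W i j • y j, (z - y) i⟫ + ∑ i, ⟪gradf i (y i), (z - y) i⟫ := by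
    rw [PiLp.inner_apply, Finset.mul_sum, ← Finset.sum_add_distrib]
    refine Finset.sum_congr rfl fun i _ => ?_
    rw [penGrad, inner_add_left, real_inner_smul_left]
  have hadd (i : Fin N) : y i + (z - y) i = z i := by simp
  simp only [hadd] at h
  rw [penObj, penObj, h, hin, Finset.sum_sub_distrib, Finset.sum_sub_distrib]
  ring

/-- **Theorem (D-ASG, explicit rate).**  Assume `λ_N^W > 0`, `0 < α ≤ λ_N^W/L` and
`β = (1−√(αμ))/(1+√(αμ))`.  Then for every `k ≥ 0` the D-ASG iterates satisfy
`E[‖x^{(k)} − x^∞‖²] ≤ 2(1−√(αμ))^k V_{S,α}(ξ₀)/μ + (σ²N√α/(μ√μ))(2 − λ_N^W + αL)`. -/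
theorem dasg_explicit_rate
    {N d : ℕ} (hN : 0 < N) (hd : 0 < d)
    (μ L α β σ : ℝ) (hμ : 0 < μ) (hμL : μ ≤ L) (hσ : 0 ≤ σ)
    -- the symmetric doubly stochastic mixing matrix and its eigenvalues, in decreasing order
    (W : Matrix (Fin N) (Fin N) ℝ)
    (hWsymm : W.IsSymm)
    (hWnonneg : ∀ i j, 0 ≤ W i j)
    (hWrow : ∀ i, ∑ j, W i j = 1)
    (hWcol : ∀ j, ∑ i, W i j = 1)
    (lam : Fin N → ℝ) (V : Matrix (Fin N) (Fin N) ℝ)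
    (hV : V * Vᵀ = 1)
    (hWeig : W = Vᵀ * Matrix.diagonal lam * V)
    (hlamAnti : Antitone lam)
    (hlamTop : lam ⟨0, hN⟩ = 1)
    (lamN : ℝ) (hlamN : lamN = lam ⟨N - 1, Nat.sub_lt hN Nat.one_pos⟩)
    (hlamNpos : 0 < lamN)
    -- stepsize and momentum
    (hα0 : 0 < α) (hαle : α ≤ lamN / L)
    (hβ : β = (1 - Real.sqrt (α * μ)) / (1 + Real.sqrt (α * μ)))
    -- the local objectives: μ-strongly convex with L-Lipschitz gradients
    (f : Fin N → EuclideanSpace ℝ (Fin d) → ℝ)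
    (gradf : Fin N → EuclideanSpace ℝ (Fin d) → EuclideanSpace ℝ (Fin d))
    (hgrad : ∀ i x, HasGradientAt (f i) (gradf i x) x)
    (hlip : ∀ i, LipschitzWith (Real.toNNReal L) (gradf i))
    (hconv : ∀ i, ConvexOn ℝ Set.univ (fun x => f i x - μ / 2 * ‖x‖ ^ 2))
    -- the fixed point x^∞ : solution of (I − 𝒲)x + α ∇F(x) = 0
    (xinf : PiLp 2 (fun _ : Fin N => EuclideanSpace ℝ (Fin d)))
    (hxinf : ∀ i, (xinf i - ∑ j, W i j • xinf j) + α • gradf i (xinf i) = 0)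
    -- probability space, filtration and the D-ASG iterates
    {Ω : Type} {mΩ : MeasurableSpace Ω} (P : Measure Ω) [IsProbabilityMeasure P]
    (ℱ : ℕ → MeasurableSpace Ω) (hℱ : ∀ k, ℱ k ≤ mΩ) (hℱmono : Monotone ℱ)
    (X Y w : ℕ → Ω → PiLp 2 (fun _ : Fin N => EuclideanSpace ℝ (Fin d)))
    (x0 xm1 : PiLp 2 (fun _ : Fin N => EuclideanSpace ℝ (Fin d)))
    (hX0 : ∀ ω, X 0 ω = x0)
    (hY0 : ∀ ω i, Y 0 ω i = (1 + β) • x0 i - β • xm1 i)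
    (hYS : ∀ k ω i, Y (k + 1) ω i = (1 + β) • X (k + 1) ω i - β • X k ω i)
    (hXadapted : ∀ k, StronglyMeasurable[ℱ k] (X k))
    (hwmeas : ∀ k, StronglyMeasurable[ℱ (k + 1)] (w (k + 1)))
    (hrec : ∀ k ω i, X (k + 1) ω i =
      (∑ j, W i j • Y k ω j) - α • gradf i (Y k ω i) - α • w (k + 1) ω i)
    -- the gradient noise: conditionally centered with conditional variance ≤ σ²N
    (hwmean : ∀ k, P[w (k + 1)|ℱ k] =ᵐ[P] 0)
    (hwL2 : ∀ k, Integrable (fun ω => ‖w (k + 1) ω‖ ^ 2) P)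
    (hwvar : ∀ k, ∀ᵐ ω ∂P, (P[fun ω' => ‖w (k + 1) ω'‖ ^ 2|ℱ k]) ω ≤ σ ^ 2 * N) :
    ∀ k : ℕ,
      ∫ ω, ‖X k ω - xinf‖ ^ 2 ∂P ≤
        2 * (1 - Real.sqrt (α * μ)) ^ k *
            (lyapS W α μ f xinf (x0 - xinf) (xm1 - xinf) / μ) +
          σ ^ 2 * N * Real.sqrt α / (μ * Real.sqrt μ) * (2 - lamN + α * L) := by
  have hL : 0 < L := hμ.trans_le hμL
  have hle (l : Fin N) : lam l ≤ 1 := hlamTop ▸ hlamAnti (Fin.mk_le_of_le_val (Nat.zero_le _))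
  have hge (l : Fin N) : lamN ≤ lam l :=
    hlamN ▸ hlamAnti (Fin.le_def.2 (Nat.le_sub_one_of_lt l.2))
  have hlamN1 : lamN ≤ 1 := hlamN ▸ hle _
  have hαL : α * L ≤ lamN := (le_div_iff₀ hL).1 hαle
  have hαμ : 0 < α * μ := mul_pos hα0 hμ
  have hαμ1 : α * μ ≤ 1 := (mul_le_mul_of_nonneg_left hμL hα0.le).trans (hαL.trans hlamN1)
  set p := √(α * μ) with hpdef
  have hp0 : 0 < p := Real.sqrt_pos.2 hαμ
  have hp1 : p ≤ 1 := Real.sqrt_le_one.2 hαμ1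
  have hp : p ^ 2 = α * μ := Real.sq_sqrt hαμ.le
  have hβ' : β * (1 + p) = 1 - p := by rw [hβ]; field_simp
  have hQ := sum_norm_sq_sub_sum_inner_bounds (E := EuclideanSpace ℝ (Fin d)) hV hWeig hle hge
  have hlow (y z) : penObj W α f y + ⟪penGrad W α gradf y, z - y⟫ + μ / 2 * ‖z - y‖ ^ 2
      ≤ penObj W α f z := by
    have h1 : μ / 2 * ‖z - y‖ ^ 2 ≤
        ∑ i, (f i (z i) - f i (y i) - ⟪gradf i (y i), (z - y) i⟫) := by
      rw [PiLp.norm_sq_eq_of_L2, Finset.mul_sum]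
      refine Finset.sum_le_sum fun i _ => ?_
      have := strongConvex_gradient_lower_bound (hgrad i (y i)) (hconv i) (z i)
      rw [PiLp.sub_apply]
      linarith
    have h2 := mul_nonneg (by positivity : 0 ≤ 1 / (2 * α)) (hQ fun i => (z - y) i).1
    rw [penObj_eq hWsymm α f gradf y z]
    linarith
  have hup (y z) : penObj W α f z ≤ penObj W α f y + ⟪penGrad W α gradf y, z - y⟫
      + (1 - lamN + α * L) / (2 * α) * ‖z - y‖ ^ 2 := by
    have h1 : ∑ i, (f i (z i) - f i (y i) - ⟪gradf i (y i), (z - y) i⟫) ≤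
        L / 2 * ‖z - y‖ ^ 2 := by
      rw [PiLp.norm_sq_eq_of_L2, Finset.mul_sum]
      refine Finset.sum_le_sum fun i _ => ?_
      have := lipschitz_gradient_upper_bound (hgrad i) (hlip i) (y i) (z i)
      rw [Real.coe_toNNReal L hL.le] at this
      rw [PiLp.sub_apply]
      linarith
    have h2 := mul_le_mul_of_nonneg_left (hQ fun i => (z - y) i).2
      (by positivity : 0 ≤ 1 / (2 * α))
    rw [penObj_eq hWsymm α f gradf y z, show (1 - lamN + α * L) / (2 * α) * ‖z - y‖ ^ 2 =
      1 / (2 * α) * ((1 - lamN) * ‖z - y‖ ^ 2) + L / 2 * ‖z - y‖ ^ 2 by field_simp]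
    rw [PiLp.norm_sq_eq_of_L2] at h1 ⊢
    linarith
  have hfc (i : Fin N) : Continuous (f i) :=
    continuous_iff_continuousAt.2 fun x => (hgrad i x).continuousAt
  have hgc (i : Fin N) : Continuous (gradf i) := (hlip i).continuous
  have hGcont : Continuous (penObj W α f) := by
    unfold penObj
    fun_prop
  have hgcont : Continuous (penGrad W α gradf) := by
    unfold penGrad
    fun_prop
  have hzero : penGrad W α gradf xinf = 0 := by
    ext1 i
    have h := congrArg (α⁻¹ • ·) (hxinf i)
    simpa [penGrad, smul_add, smul_smul, inv_mul_cancel₀ hα0.ne'] using h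
  let X' : ℕ → Ω → PiLp 2 (fun _ : Fin N => EuclideanSpace ℝ (Fin d)) := fun k =>
    Nat.casesOn k (fun _ => xm1) X
  have hYX (k : ℕ) (ω : Ω) : Y k ω = (1 + β) • X k ω - β • X' k ω := by
    ext1 i
    cases k with
    | zero => simp [hY0, hX0, X']
    | succ k => simp [hYS, X']
  have hrec' (k : ℕ) (ω : Ω) : X (k + 1) ω = ((1 + β) • X k ω - β • X' k ω)
      - α • penGrad W α gradf ((1 + β) • X k ω - β • X' k ω) - α • w (k + 1) ω := by
    rw [← hYX]
    ext1 i
    simp only [hrec, penGrad, PiLp.sub_apply, PiLp.smul_apply, smul_add, smul_smul,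
      mul_inv_cancel₀ hα0.ne', one_smul]
    abel
  intro k
  have key := nesterov_expected_sq_dist_le hα0 hμ hp0 hp1 hp hβ' (M := 1 - lamN + α * L)
    (by nlinarith) (by linarith) (by positivity) hlow hup hGcont hgcont xinf hzero P ℱ hℱ hℱmono
    X X' w x0 xm1 hX0 (fun _ => rfl) (fun _ => rfl) hXadapted hwmeas hrec' hwmean hwL2 hwvar k
  have hlyap : lyapS W α μ f xinf (x0 - xinf) (xm1 - xinf) =
      1 / (2 * α) * ‖(x0 - xinf) - (1 - p) • (xm1 - xinf)‖ ^ 2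
        + (penObj W α f x0 - penObj W α f xinf) := by
    have hsqrt : √(μ / 2) = p * √(1 / (2 * α)) := by
      rw [hpdef, ← Real.sqrt_mul hαμ.le]
      congr 1
      field_simp
    rw [lyapS, hsqrt, sub_add_cancel, show √(1 / (2 * α)) • (x0 - xinf)
        + (p * √(1 / (2 * α)) - √(1 / (2 * α))) • (xm1 - xinf) =
        √(1 / (2 * α)) • ((x0 - xinf) - (1 - p) • (xm1 - xinf)) by module,
      norm_smul, mul_pow, Real.norm_eq_abs, sq_abs, Real.sq_sqrt (by positivity)]
    ring
  have hnoise : σ ^ 2 * N * √α / (μ * √μ) * (2 - lamN + α * L) =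
      2 / μ * (α / 2 * (1 + (1 - lamN + α * L)) * (σ ^ 2 * N) / p) := by
    have hsα := Real.sq_sqrt hα0.le
    have hsα0 := Real.sqrt_pos.2 hα0
    have hsμ0 := Real.sqrt_pos.2 hμ
    rw [hpdef, Real.sqrt_mul hα0.le]
    field_simp
    rw [hsα]
    ring
  rw [← hlyap] at key
  have h := mul_le_mul_of_nonneg_left key (by positivity : 0 ≤ 2 / μ)
  rw [← mul_assoc, show 2 / μ * (μ / 2) = 1 by field_simp, one_mul, mul_add, ← hnoise] at h
  refine h.trans_eq ?_
  ring
end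

section
/- Let α > 0 and β ∈ ℝ, and let μ₁,…,μ_{Nd} be the (real) eigenvalues of the symmetric matrix 𝒲 − αQ. Then the spectral radius of the 2Nd×2Nd block matrix A_{dasg,Q} equals the maximum over 1 ≤ i ≤ Nd of max{|z| : z ∈ ℂ, z² − (1+β)μ_i·z + βμ_i = 0}; that is, ρ(A_{dasg,Q}) = max_{1≤i≤Nd} |((1+β)μ_i ± √((1+β)²μ_i² − 4βμ_i))/2|, the square root taken in ℂ. -/
open MeasureTheory Filter Real
open scoped RealInnerProductSpace ENNReal NNReal Matrix

/-- `𝒲 = W ⊗ I_d` as a matrix indexed by `Fin N × Fin d`. -/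
noncomputable def liftW {N d : ℕ} (W : Matrix (Fin N) (Fin N) ℝ) :
    Matrix (Fin N × Fin d) (Fin N × Fin d) ℝ :=
  Matrix.of fun p q => W p.1 q.1 * (if p.2 = q.2 then 1 else 0)

/-- `Q = blockdiag(Q₁, …, Q_N)` as a matrix indexed by `Fin N × Fin d`. -/
noncomputable def blockDiagQ {N d : ℕ} (Qm : Fin N → Matrix (Fin d) (Fin d) ℝ) :
    Matrix (Fin N × Fin d) (Fin N × Fin d) ℝ :=
  Matrix.of fun p q => if p.1 = q.1 then Qm p.1 p.2 q.2 else 0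

/-- The D-ASG iteration matrix `A_{dasg,Q} = [[(1+β)(𝒲−αQ), −β(𝒲−αQ)], [I, 0]]`. -/
noncomputable def AdasgQ {N d : ℕ} (W : Matrix (Fin N) (Fin N) ℝ)
    (Qm : Fin N → Matrix (Fin d) (Fin d) ℝ) (α β : ℝ) :
    Matrix ((Fin N × Fin d) ⊕ (Fin N × Fin d)) ((Fin N × Fin d) ⊕ (Fin N × Fin d)) ℝ :=
  Matrix.fromBlocks ((1 + β) • (liftW W - α • blockDiagQ Qm))
    ((-β) • (liftW W - α • blockDiagQ Qm)) 1 0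

/-- A companion-type block matrix is invertible exactly when the associated matrix polynomial is. -/
theorem isUnit_fromBlocks_neg_one_scalar {n R : Type*} [Fintype n] [DecidableEq n] [CommRing R]
    (X Y : Matrix n n R) (z : R) :
    IsUnit (Matrix.fromBlocks X Y (-1 : Matrix n n R) (z • (1 : Matrix n n R))) ↔
      IsUnit (z • X + Y) := by
  have hR : IsUnit (Matrix.fromBlocks (z • (1 : Matrix n n R)) (-1 : Matrix n n R)
      (1 : Matrix n n R) (0 : Matrix n n R)) := by
    refine IsUnit.of_mul_eq_one
      (Matrix.fromBlocks (0 : Matrix n n R) 1 (-1) (z • (1 : Matrix n n R))) ?_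
    simp [Matrix.fromBlocks_multiply]
  have hmul : Matrix.fromBlocks X Y (-1 : Matrix n n R) (z • (1 : Matrix n n R)) *
      Matrix.fromBlocks (z • (1 : Matrix n n R)) (-1 : Matrix n n R)
        (1 : Matrix n n R) (0 : Matrix n n R) =
      Matrix.fromBlocks (z • X + Y) (-X) 0 1 := by
    simp [Matrix.fromBlocks_multiply]
  rw [← hR.mul_right_iff, hmul, Matrix.isUnit_fromBlocks_zero₂₁]
  simp

/-- The spectrum of `[[a M, b M], [1, 0]]` for a diagonalized matrix `M`. -/
theorem mem_spectrum_fromBlocks_smul_iff {n K : Type*} [Fintype n] [DecidableEq n] [Field K]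
    {M U V : Matrix n n K} {m : n → K} (hVU : V * U = 1) (hM : M = V * Matrix.diagonal m * U)
    (a b z : K) :
    z ∈ spectrum K (Matrix.fromBlocks (a • M) (b • M) (1 : Matrix n n K) (0 : Matrix n n K)) ↔
      ∃ i, z ^ 2 - a * m i * z - b * m i = 0 := by
  have hblock : algebraMap K (Matrix (n ⊕ n) (n ⊕ n) K) z -
      Matrix.fromBlocks (a • M) (b • M) (1 : Matrix n n K) (0 : Matrix n n K) =
      Matrix.fromBlocks (z • 1 - a • M) (-(b • M)) (-1 : Matrix n n K) (z • (1 : Matrix n n K)) := by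
    rw [Algebra.algebraMap_eq_smul_one, ← Matrix.fromBlocks_one, Matrix.fromBlocks_smul,
      sub_eq_add_neg, Matrix.fromBlocks_neg, Matrix.fromBlocks_add]
    simp [sub_eq_add_neg]
  have hdiag : Matrix.diagonal (fun i => z ^ 2 - a * m i * z - b * m i) =
      (z ^ 2) • (1 : Matrix n n K) - (z * a + b) • Matrix.diagonal m := by
    ext i j
    by_cases h : i = j
    · subst h
      simp
      ring
    · simp [h]
  have hpoly : z • (z • 1 - a • M) + -(b • M) =
      V * Matrix.diagonal (fun i => z ^ 2 - a * m i * z - b * m i) * U := by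
    rw [hdiag, mul_sub, sub_mul, mul_smul_comm, mul_one, smul_mul_assoc, hVU, mul_smul_comm,
      smul_mul_assoc, ← hM]
    module
  have hU : IsUnit U := IsUnit.of_mul_eq_one_right V hVU
  have hV : IsUnit V := IsUnit.of_mul_eq_one U hVU
  rw [spectrum.mem_iff, hblock, isUnit_fromBlocks_neg_one_scalar, hpoly, hU.mul_right_iff,
    hV.mul_left_iff, Matrix.isUnit_diagonal, Pi.isUnit_iff]
  simp

/-- **Proposition (spectral radius of the D-ASG iteration matrix, quadratic case).**
Let `μ₁,…,μ_{Nd}` be the eigenvalues of `𝒲 − αQ`.  Then the spectral radius of the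
`2Nd×2Nd` block matrix `A_{dasg,Q}` is the maximum over `i` of
`max{|z| : z ∈ ℂ, z² − (1+β)μ_i z + βμ_i = 0}`. -/
theorem dasg_quadratic_spectral_radius
    {N d : ℕ} (hN : 0 < N) (hd : 0 < d)
    (μ L α β : ℝ) (hμ : 0 < μ) (hμL : μ ≤ L) (hα : 0 < α)
    -- the symmetric doubly stochastic mixing matrix and its eigenvalues, in decreasing order
    (W : Matrix (Fin N) (Fin N) ℝ)
    (hWsymm : W.IsSymm)
    (hWnonneg : ∀ i j, 0 ≤ W i j)
    (hWrow : ∀ i, ∑ j, W i j = 1)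
    (hWcol : ∀ j, ∑ i, W i j = 1)
    (lam : Fin N → ℝ) (V : Matrix (Fin N) (Fin N) ℝ)
    (hV : V * Vᵀ = 1)
    (hWeig : W = Vᵀ * Matrix.diagonal lam * V)
    (hlamAnti : Antitone lam)
    (hlamTop : lam ⟨0, hN⟩ = 1)
    -- the quadratic local objectives: f_i(x) = ½xᵀQ_ix − p_iᵀx + r_i with μI ⪯ Q_i ⪯ LI
    (Qm : Fin N → Matrix (Fin d) (Fin d) ℝ)
    (hQsymm : ∀ i, (Qm i).IsSymm)
    (hQlb : ∀ i, (Qm i - μ • (1 : Matrix (Fin d) (Fin d) ℝ)).PosSemidef)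
    (hQub : ∀ i, (L • (1 : Matrix (Fin d) (Fin d) ℝ) - Qm i).PosSemidef)
    (pv : Fin N → EuclideanSpace ℝ (Fin d)) (rv : Fin N → ℝ)
    -- the eigenvalues μ_i of 𝒲 − αQ, via an orthogonal diagonalization
    (mu : Fin N × Fin d → ℝ) (U : Matrix (Fin N × Fin d) (Fin N × Fin d) ℝ)
    (hU : U * Uᵀ = 1)
    (hAQeig : liftW W - α • blockDiagQ Qm = Uᵀ * Matrix.diagonal mu * U) :
    spectralRadius ℂ ((AdasgQ W Qm α β).map (Complex.ofReal ·)) =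
      ⨆ i : Fin N × Fin d,
        ⨆ z ∈ {z : ℂ | z ^ 2 - ((1 + β) * mu i) * z + β * mu i = 0},
          (‖z‖₊ : ℝ≥0∞) := by
  have hM : (liftW W - α • blockDiagQ Qm).map Complex.ofRealHom =
      (Uᵀ.map Complex.ofRealHom) * Matrix.diagonal (fun i => (mu i : ℂ)) *
        U.map Complex.ofRealHom := by
    rw [hAQeig, Matrix.map_mul, Matrix.map_mul, Matrix.diagonal_map (map_zero _)]
    rfl
  have hUU : Uᵀ.map Complex.ofRealHom * U.map Complex.ofRealHom = 1 := by
    rw [← Matrix.map_mul, mul_eq_one_comm.mp hU, Matrix.map_one _ (map_zero _) (map_one _)]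
  have hA : (AdasgQ W Qm α β).map (Complex.ofReal ·) =
      Matrix.fromBlocks
        ((1 + β : ℂ) • (liftW W - α • blockDiagQ Qm).map Complex.ofRealHom)
        ((-β : ℂ) • (liftW W - α • blockDiagQ Qm).map Complex.ofRealHom) 1 0 := by
    rw [AdasgQ, Matrix.fromBlocks_map, Matrix.map_one _ Complex.ofReal_zero Complex.ofReal_one,
      Matrix.map_zero _ Complex.ofReal_zero]
    congr 1 <;> ext i j <;> simp
  have hspec (z : ℂ) : z ∈ spectrum ℂ ((AdasgQ W Qm α β).map (Complex.ofReal ·)) ↔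
      ∃ i, z ^ 2 - ((1 + β) * mu i) * z + β * mu i = 0 := by
    rw [hA, mem_spectrum_fromBlocks_smul_iff hUU hM]
    simp [sub_neg_eq_add]
  simp only [spectralRadius, hspec, iSup_exists, Set.mem_ofPred_eq]
  rw [iSup_comm]
end

section
/- Let η ≥ 0 and suppose the D-SG noise satisfies, almost surely, E[w^{(k+1)} | ℱ_k] = 0 and E[‖w^{(k+1)}‖² | ℱ_k] ≤ σ²N + (η²/2)‖x^{(k)} − x^*‖². Assume 0 < α ≤ (1/2 + λ_N^W)/(L + η²/μ) and ‖x^∞ − x^*‖ ≤ αC₁√N/(1−γ). Then for every k ≥ 0, E[‖x^{(k)} − x^*‖²] ≤ 2(1 − αμ/2)^k·‖x^{(0)} − x^∞‖² + (4α/μ)·(σ² + η²α²C₁²/(1−γ)²)·N + 2α²C₁²N/(1−γ)². -/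
open MeasureTheory Filter Real ProbabilityTheory
open scoped RealInnerProductSpace ENNReal NNReal Matrix

section Gradient

variable {E : Type*} [NormedAddCommGroup E] [InnerProductSpace ℝ E] [CompleteSpace E]

theorem HasGradientAt.hasDerivAt_comp_add_smul {f : E → ℝ} {g x v : E} {t : ℝ}
    (h : HasGradientAt f g (x + t • v)) :
    HasDerivAt (fun s : ℝ => f (x + s • v)) ⟪g, v⟫ t := by
  have hl : HasDerivAt (fun s : ℝ => x + s • v) v t := by
    simpa using ((hasDerivAt_id t).smul_const v).const_add x
  exact (h.hasFDerivAt.comp_hasDerivAt t hl).congr_deriv (by simp)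

theorem ConvexOn.add_inner_le_of_hasGradientAt {f : E → ℝ} {g x : E}
    (hf : ConvexOn ℝ Set.univ f) (h : HasGradientAt f g x) (y : E) :
    f x + ⟪g, y - x⟫ ≤ f y := by
  have hc : ConvexOn ℝ Set.univ (fun s : ℝ => f (x + s • (y - x))) := by
    have := hf.comp_affineMap (AffineMap.lineMap x y)
    simpa [Function.comp_def, AffineMap.lineMap_apply, add_comm] using this
  have hd : HasDerivAt (fun s : ℝ => f (x + s • (y - x))) ⟪g, y - x⟫ 0 :=
    HasGradientAt.hasDerivAt_comp_add_smul (by simpa using h)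
  have := hc.le_slope_of_hasDerivAt (Set.mem_univ 0) (Set.mem_univ 1) zero_lt_one hd
  simp [slope] at this
  linarith

theorem add_inner_add_le_of_strongly_convex {f : E → ℝ} {g x : E} {μ : ℝ}
    (hf : ConvexOn ℝ Set.univ (fun z => f z - μ / 2 * ‖z‖ ^ 2)) (h : HasGradientAt f g x) (y : E) :
    f x + ⟪g, y - x⟫ + μ / 2 * ‖y - x‖ ^ 2 ≤ f y := by
  have hn : HasGradientAt (fun z => f z - μ / 2 * ‖z‖ ^ 2) (g - μ • x) x := by
    rw [hasGradientAt_iff_hasFDerivAt]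
    have := h.hasFDerivAt.sub (((hasStrictFDerivAt_norm_sq x).hasFDerivAt).const_mul (μ / 2))
    refine this.congr_fderiv ?_
    ext z
    simp
    ring
  have := hf.add_inner_le_of_hasGradientAt hn y
  rw [norm_sub_sq_real]
  simp only [inner_sub_left, inner_sub_right, inner_smul_left, real_inner_self_eq_norm_sq,
    real_inner_comm x y, conj_trivial] at this ⊢
  linarith

theorem LipschitzWith.le_add_inner_add_of_hasGradientAt {f : E → ℝ} {g : E → E} {L : ℝ≥0}
    (hg : LipschitzWith L g) (h : ∀ x, HasGradientAt f (g x) x) (x y : E) :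
    f y ≤ f x + ⟪g x, y - x⟫ + L / 2 * ‖y - x‖ ^ 2 := by
  set v := y - x with hv
  have hd : ∀ t : ℝ, HasDerivAt
      (fun s : ℝ => f (x + s • v) - s * ⟪g x, v⟫ - L / 2 * ‖v‖ ^ 2 * s ^ 2)
      (⟪g (x + t • v), v⟫ - ⟪g x, v⟫ - L * ‖v‖ ^ 2 * t) t := fun t => by
    have := ((h (x + t • v)).hasDerivAt_comp_add_smul.sub
      ((hasDerivAt_id t).mul_const ⟪g x, v⟫)).sub
        ((hasDerivAt_pow 2 t).const_mul ((L : ℝ) / 2 * ‖v‖ ^ 2))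
    refine this.congr_deriv ?_
    simp
    ring
  have ha : AntitoneOn
      (fun s : ℝ => f (x + s • v) - s * ⟪g x, v⟫ - L / 2 * ‖v‖ ^ 2 * s ^ 2) (Set.Ici 0) := by
    refine antitoneOn_of_hasDerivWithinAt_nonpos (convex_Ici 0)
      (fun t _ => (hd t).continuousAt.continuousWithinAt)
      (fun t _ => (hd t).hasDerivWithinAt) fun t ht => ?_
    have ht : 0 < t := by simpa using ht
    have h1 : ⟪g (x + t • v) - g x, v⟫ ≤ ‖g (x + t • v) - g x‖ * ‖v‖ := real_inner_le_norm _ _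
    have h2 : ‖g (x + t • v) - g x‖ ≤ L * (t * ‖v‖) := by
      simpa [norm_smul, abs_of_pos ht] using hg.norm_sub_le (x + t • v) x
    rw [inner_sub_left] at h1
    nlinarith [mul_le_mul_of_nonneg_right h2 (norm_nonneg v)]
  have := ha (a := 0) (b := 1) (by simp) (by simp) zero_le_one
  simp [hv] at this ⊢
  linarith

theorem LipschitzWith.norm_sub_sq_le_mul_inner_of_hasGradientAt {f : E → ℝ} {g : E → E} {L : ℝ≥0}
    (hg : LipschitzWith L g) (hL : 0 < L) (h : ∀ x, HasGradientAt f (g x) x)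
    (hf : ConvexOn ℝ Set.univ f) (x y : E) :
    ‖g x - g y‖ ^ 2 ≤ L * ⟪g x - g y, x - y⟫ := by
  have hL' : (0 : ℝ) < L := hL
  have key : ∀ x y : E, ‖g y - g x‖ ^ 2 ≤ 2 * L * (f y - f x - ⟪g x, y - x⟫) := fun x y => by
    have h1 := hf.add_inner_le_of_hasGradientAt (h x) (y - (L : ℝ)⁻¹ • (g y - g x))
    have h2 := hg.le_add_inner_add_of_hasGradientAt h y (y - (L : ℝ)⁻¹ • (g y - g x))
    have h3 : ⟪g x, y - (L : ℝ)⁻¹ • (g y - g x) - x⟫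
        = ⟪g x, y - x⟫ - (L : ℝ)⁻¹ * ⟪g x, g y - g x⟫ := by
      rw [sub_right_comm, inner_sub_right, inner_smul_right]
    have h4 : ⟪g y, g y - g x⟫ - ⟪g x, g y - g x⟫ = ‖g y - g x‖ ^ 2 := by
      rw [← inner_sub_left, real_inner_self_eq_norm_sq]
    simp only [sub_sub_cancel_left, inner_neg_right, inner_smul_right, norm_neg, norm_smul,
      norm_inv, Real.norm_eq_abs, NNReal.abs_eq, mul_pow] at h2
    rw [h3] at h1
    have h5 : (L : ℝ) / 2 * ((L : ℝ)⁻¹ ^ 2 * ‖g y - g x‖ ^ 2)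
        = (L : ℝ)⁻¹ * (‖g y - g x‖ ^ 2 / 2) := by
      field_simp
    have h6 : (L : ℝ)⁻¹ * (‖g y - g x‖ ^ 2 / 2) ≤ f y - f x - ⟪g x, y - x⟫ := by
      rw [h5] at h2
      rw [← h4] at h2 ⊢
      linarith
    rw [inv_mul_le_iff₀ hL'] at h6
    linarith
  have h1 := key x y
  have h2 := key y x
  rw [norm_sub_rev] at h1
  have h3 : ⟪g x - g y, x - y⟫ = -⟪g x, y - x⟫ - ⟪g y, x - y⟫ := by
    rw [← neg_sub x y, inner_neg_right, inner_sub_left]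
    ring
  rw [h3]
  linarith

theorem mul_norm_sub_sq_le_inner_of_strongly_convex {f : E → ℝ} {g : E → E} {μ : ℝ}
    (hf : ConvexOn ℝ Set.univ (fun z => f z - μ / 2 * ‖z‖ ^ 2)) (h : ∀ x, HasGradientAt f (g x) x)
    (x y : E) : μ * ‖x - y‖ ^ 2 ≤ ⟪g x - g y, x - y⟫ := by
  have h1 := add_inner_add_le_of_strongly_convex hf (h x) y
  have h2 := add_inner_add_le_of_strongly_convex hf (h y) x
  rw [← neg_sub x y, inner_neg_right, norm_neg] at h1
  rw [inner_sub_left]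
  linarith

end Gradient

theorem norm_add_sq_le_mul_inner_add {E : Type*} [NormedAddCommGroup E] [InnerProductSpace ℝ E]
    {u h e : E} {m l : ℝ} (hm : 0 ≤ m) (hl : 0 ≤ l) (hue : 0 ≤ ⟪u, e⟫) (hhe : 0 ≤ ⟪h, e⟫)
    (hu : ‖u‖ ^ 2 ≤ m * ⟪u, e⟫) (hh : ‖h‖ ^ 2 ≤ l * ⟪h, e⟫) :
    ‖u + h‖ ^ 2 ≤ (m + l) * ⟪u + h, e⟫ := by
  have h1 : ⟪u, h⟫ ≤ ‖u‖ * ‖h‖ := real_inner_le_norm _ _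
  have h2 : (2 * (‖u‖ * ‖h‖)) ^ 2 ≤ (m * ⟪h, e⟫ + l * ⟪u, e⟫) ^ 2 := by
    have := mul_le_mul hu hh (by positivity) (by positivity)
    nlinarith [sq_nonneg (m * ⟪h, e⟫ - l * ⟪u, e⟫)]
  have h3 := abs_le_of_sq_le_sq' h2 (by positivity)
  rw [norm_add_sq_real, inner_add_left]
  linarith [h3.2]

theorem integral_norm_sub_smul_sq_of_condExp_eq_zero
    {E Ω : Type*} [NormedAddCommGroup E] [InnerProductSpace ℝ E] [CompleteSpace E]
    {m mΩ : MeasurableSpace Ω} {P : Measure Ω} [IsProbabilityMeasure P] (hm : m ≤ mΩ)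
    {Y w : Ω → E} (hYm : StronglyMeasurable[m] Y) (hY : MemLp Y 2 P) (hw : MemLp w 2 P)
    (hw0 : P[w|m] =ᵐ[P] 0) (a : ℝ) :
    ∫ ω, ‖Y ω - a • w ω‖ ^ 2 ∂P = ∫ ω, ‖Y ω‖ ^ 2 ∂P + a ^ 2 * ∫ ω, ‖w ω‖ ^ 2 ∂P := by
  have hint : Integrable (fun ω => ⟪Y ω, w ω⟫) P := by
    refine (hY.norm.integrable_mul hw.norm).mono'
      (hY.aestronglyMeasurable.inner hw.aestronglyMeasurable) (ae_of_all _ fun ω => ?_)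
    exact norm_inner_le_norm _ _
  have h0 : ∫ ω, ⟪Y ω, w ω⟫ ∂P = 0 := by
    rw [← integral_condExp hm]
    have := condExp_bilin_of_stronglyMeasurable_left (μ := P) (innerSL ℝ) hYm
      hint (hw.integrable one_le_two)
    refine integral_eq_zero_of_ae ?_
    filter_upwards [this, hw0] with ω h1 h2
    refine h1.trans ?_
    simp [h2]
  have hexp : ∀ ω, ‖Y ω - a • w ω‖ ^ 2
      = ‖Y ω‖ ^ 2 - 2 * a * ⟪Y ω, w ω⟫ + a ^ 2 * ‖w ω‖ ^ 2 := fun ω => by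
    rw [norm_sub_sq_real, inner_smul_right, norm_smul, mul_pow, Real.norm_eq_abs, sq_abs]
    ring
  have hY2 := hY.integrable_norm_pow two_ne_zero
  have hw2 := hw.integrable_norm_pow two_ne_zero
  simp_rw [hexp]
  rw [integral_add (f := fun ω => ‖Y ω‖ ^ 2 - 2 * a * ⟪Y ω, w ω⟫)
      (hY2.sub (hint.const_mul _)) (hw2.const_mul _),
    integral_sub hY2 (hint.const_mul _), integral_const_mul, integral_const_mul, h0]
  ring

theorem norm_sub_sq_le_of_norm_sq_le_mul_inner {E : Type*} [NormedAddCommGroup E]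
    [InnerProductSpace ℝ E] {v e : E} {b c κ : ℝ} (hb : 0 ≤ b) (hbc : c ≤ 2 - b)
    (hκ : 0 ≤ κ) (hv : ‖v‖ ^ 2 ≤ c * ⟪v, e⟫) (hve : κ * ‖e‖ ^ 2 ≤ ⟪v, e⟫) :
    ‖e - v‖ ^ 2 ≤ (1 - b * κ) * ‖e‖ ^ 2 := by
  have h0 : 0 ≤ ⟪v, e⟫ := le_trans (by positivity) hve
  rw [norm_sub_sq_real, real_inner_comm]
  nlinarith [mul_le_mul_of_nonneg_left hve hb, mul_le_mul_of_nonneg_right hbc h0]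

section Mixing

variable {ι E : Type*} [Fintype ι] [DecidableEq ι] [NormedAddCommGroup E] [InnerProductSpace ℝ E]

theorem Matrix.sum_inner_sum_smul_of_transpose_mul_self {V : Matrix ι ι ℝ} (hV : Vᵀ * V = 1)
    (a b : ι → E) :
    ∑ i, ⟪∑ j, V i j • a j, ∑ j, V i j • b j⟫ = ∑ j, ⟪a j, b j⟫ := by
  have h : ∀ j k, ∑ i, V i j * V i k = if j = k then 1 else 0 := fun j k => by
    simpa [Matrix.mul_apply, Matrix.one_apply] using congrFun (congrFun hV j) k
  calc ∑ i, ⟪∑ j, V i j • a j, ∑ j, V i j • b j⟫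
      = ∑ i, ∑ j, ∑ k, V i j * V i k * ⟪a j, b k⟫ := by
        simp only [sum_inner, inner_sum, inner_smul_left, inner_smul_right, conj_trivial,
          Finset.mul_sum]
        refine Finset.sum_congr rfl fun i _ => Finset.sum_comm.trans ?_
        exact Finset.sum_congr rfl fun j _ => Finset.sum_congr rfl fun k _ => by ring
    _ = ∑ j, ∑ k, (∑ i, V i j * V i k) * ⟪a j, b k⟫ := by
        simp only [Finset.sum_mul]
        rw [Finset.sum_comm]
        exact Finset.sum_congr rfl fun j _ => Finset.sum_comm
    _ = ∑ j, ⟪a j, b j⟫ := by simp [h]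

theorem Matrix.sum_smul_sub_sum_smul_of_eq_transpose_mul_diagonal_mul {W V : Matrix ι ι ℝ}
    {lam : ι → ℝ} (hV : V * Vᵀ = 1) (hW : W = Vᵀ * Matrix.diagonal lam * V) (e : ι → E) (i : ι) :
    ∑ j, V i j • (e j - ∑ k, W j k • e k) = (1 - lam i) • ∑ j, V i j • e j := by
  have hVW : V * W = Matrix.diagonal lam * V := by
    rw [hW, Matrix.mul_assoc, ← Matrix.mul_assoc, hV, Matrix.one_mul]
  have h : ∀ k, ∑ j, V i j * W j k = lam i * V i k := fun k => by
    rw [← Matrix.diagonal_mul, ← hVW, Matrix.mul_apply]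
  simp only [smul_sub, Finset.sum_sub_distrib, Finset.smul_sum, smul_smul, sub_mul, one_mul,
    sub_smul]
  rw [Finset.sum_comm]
  simp only [← Finset.sum_smul, h]

theorem Matrix.inner_nonneg_and_norm_sq_le_of_eq_transpose_mul_diagonal_mul {W V : Matrix ι ι ℝ}
    {lam : ι → ℝ} (hV : V * Vᵀ = 1) (hW : W = Vᵀ * Matrix.diagonal lam * V) {m : ℝ}
    (hle : ∀ i, lam i ≤ 1) (hm : ∀ i, 1 - lam i ≤ m) {u e : PiLp 2 fun _ : ι => E}
    (hu : ∀ i, u i = e i - ∑ j, W i j • e j) :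
    0 ≤ ⟪u, e⟫ ∧ ‖u‖ ^ 2 ≤ m * ⟪u, e⟫ := by
  have hV' : Vᵀ * V = 1 := mul_eq_one_comm.mp hV
  have hVu : ∀ i, ∑ j, V i j • u j = (1 - lam i) • ∑ j, V i j • e j := fun i => by
    simp only [hu]
    exact sum_smul_sub_sum_smul_of_eq_transpose_mul_diagonal_mul hV hW (fun j => e j) i
  have h1 : ⟪u, e⟫ = ∑ i, (1 - lam i) * ‖∑ j, V i j • e j‖ ^ 2 := by
    rw [PiLp.inner_apply, ← sum_inner_sum_smul_of_transpose_mul_self hV' (fun j => u j)]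
    simp only [hVu, inner_smul_left, conj_trivial, real_inner_self_eq_norm_sq]
  have h2 : ‖u‖ ^ 2 = ∑ i, (1 - lam i) * ((1 - lam i) * ‖∑ j, V i j • e j‖ ^ 2) := by
    rw [← real_inner_self_eq_norm_sq, PiLp.inner_apply,
      ← sum_inner_sum_smul_of_transpose_mul_self hV' (fun j => u j)]
    simp only [hVu, inner_smul_left, inner_smul_right, conj_trivial, real_inner_self_eq_norm_sq]
  have h0 : ∀ i, 0 ≤ (1 - lam i) * ‖∑ j, V i j • e j‖ ^ 2 := fun i =>
    mul_nonneg (sub_nonneg.2 (hle i)) (sq_nonneg _)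
  rw [h2, h1, Finset.mul_sum]
  exact ⟨Finset.sum_nonneg fun i _ => h0 i,
    Finset.sum_le_sum fun i _ => mul_le_mul_of_nonneg_right (hm i) (h0 i)⟩

end Mixing

theorem le_pow_mul_add_div_of_le_mul_add {a : ℕ → ℝ} {r c : ℝ} (hr : 0 ≤ r) (hr1 : r < 1)
    (hc : 0 ≤ c) (h : ∀ k, a (k + 1) ≤ r * a k + c) (k : ℕ) :
    a k ≤ r ^ k * a 0 + c / (1 - r) := by
  have hr1' : 0 < 1 - r := sub_pos.2 hr1
  induction k with
  | zero => simpa using div_nonneg hc hr1'.le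
  | succ k ih =>
    have h1 : r * (c / (1 - r)) + c = c / (1 - r) := by field_simp; ring
    calc a (k + 1) ≤ r * (r ^ k * a 0 + c / (1 - r)) + c :=
          (h k).trans (by gcongr)
      _ = r ^ (k + 1) * a 0 + c / (1 - r) := by rw [mul_add, add_assoc, h1]; ring

theorem norm_sub_sq_le_two_mul_add {E : Type*} [SeminormedAddCommGroup E] (x y z : E) :
    ‖x - z‖ ^ 2 ≤ 2 * ‖x - y‖ ^ 2 + 2 * ‖y - z‖ ^ 2 := by
  have h := norm_sub_le_norm_sub_add_norm_sub x y z
  have h' := pow_le_pow_left₀ (norm_nonneg _) h 2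
  nlinarith [sq_nonneg (‖x - y‖ - ‖y - z‖)]

/-- **Theorem (D-SG under state-dependent gradient noise).**
Suppose the noise satisfies `E[w^{(k+1)}|ℱ_k] = 0` and
`E[‖w^{(k+1)}‖²|ℱ_k] ≤ σ²N + (η²/2)‖x^{(k)} − x^*‖²`, and assume
`0 < α ≤ (1/2 + λ_N^W)/(L + η²/μ)` and `‖x^∞ − x^*‖ ≤ αC₁√N/(1−γ)`.  Then for every `k ≥ 0`,
`E[‖x^{(k)} − x^*‖²] ≤ 2(1 − αμ/2)^k‖x^{(0)} − x^∞‖²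
  + (4α/μ)(σ² + η²α²C₁²/(1−γ)²)N + 2α²C₁²N/(1−γ)²`. -/
theorem dsg_general_noise_bound
    {N d : ℕ} (hN : 0 < N) (hd : 0 < d)
    (μ L α σ η : ℝ) (hμ : 0 < μ) (hμL : μ ≤ L) (hσ : 0 ≤ σ) (hη : 0 ≤ η)
    -- the symmetric doubly stochastic mixing matrix and its eigenvalues, in decreasing order
    (W : Matrix (Fin N) (Fin N) ℝ)
    (hWsymm : W.IsSymm)
    (hWnonneg : ∀ i j, 0 ≤ W i j)
    (hWrow : ∀ i, ∑ j, W i j = 1)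
    (hWcol : ∀ j, ∑ i, W i j = 1)
    (lam : Fin N → ℝ) (V : Matrix (Fin N) (Fin N) ℝ)
    (hV : V * Vᵀ = 1)
    (hWeig : W = Vᵀ * Matrix.diagonal lam * V)
    (hlamAnti : Antitone lam)
    (hlamTop : lam ⟨0, hN⟩ = 1)
    (lamN : ℝ) (hlamN : lamN = lam ⟨N - 1, Nat.sub_lt hN Nat.one_pos⟩)
    (hlamNgt : -1 < lamN)
    -- γ = max{|λ₂|, |λ_N|} < 1 and a constant C₁ ≥ 0
    (γ C₁ : ℝ) (hγdef : ∀ h2 : 1 < N, γ = max |lam ⟨1, h2⟩| |lamN|)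
    (hγ0 : 0 ≤ γ) (hγ1 : γ < 1) (hC₁ : 0 ≤ C₁)
    -- stepsize
    (hα0 : 0 < α) (hαle : α ≤ (1 / 2 + lamN) / (L + η ^ 2 / μ))
    -- the local objectives: μ-strongly convex with L-Lipschitz gradients
    (f : Fin N → EuclideanSpace ℝ (Fin d) → ℝ)
    (gradf : Fin N → EuclideanSpace ℝ (Fin d) → EuclideanSpace ℝ (Fin d))
    (hgrad : ∀ i x, HasGradientAt (f i) (gradf i x) x)
    (hlip : ∀ i, LipschitzWith (Real.toNNReal L) (gradf i))
    (hconv : ∀ i, ConvexOn ℝ Set.univ (fun x => f i x - μ / 2 * ‖x‖ ^ 2))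
    -- the minimizer x_* of f = (1/N)∑ f_i, and x^* = (x_*,…,x_*)
    (xstar : EuclideanSpace ℝ (Fin d))
    (hxstar : ∀ y, (1 / (N : ℝ)) * ∑ i, f i xstar ≤ (1 / (N : ℝ)) * ∑ i, f i y)
    (xstarN : PiLp 2 (fun _ : Fin N => EuclideanSpace ℝ (Fin d)))
    (hxstarN : ∀ i, xstarN i = xstar)
    -- the fixed point x^∞ : solution of (I − 𝒲)x + α ∇F(x) = 0
    (xinf : PiLp 2 (fun _ : Fin N => EuclideanSpace ℝ (Fin d)))
    (hxinf : ∀ i, (xinf i - ∑ j, W i j • xinf j) + α • gradf i (xinf i) = 0)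
    (hxinfstar : ‖xinf - xstarN‖ ≤ α * C₁ * Real.sqrt N / (1 - γ))
    -- probability space, filtration and the D-SG iterates
    {Ω : Type} {mΩ : MeasurableSpace Ω} (P : Measure Ω) [IsProbabilityMeasure P]
    (ℱ : ℕ → MeasurableSpace Ω) (hℱ : ∀ k, ℱ k ≤ mΩ) (hℱmono : Monotone ℱ)
    (X w : ℕ → Ω → PiLp 2 (fun _ : Fin N => EuclideanSpace ℝ (Fin d)))
    (x0 : PiLp 2 (fun _ : Fin N => EuclideanSpace ℝ (Fin d)))
    (hX0 : ∀ ω, X 0 ω = x0)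
    (hXadapted : ∀ k, StronglyMeasurable[ℱ k] (X k))
    (hwmeas : ∀ k, StronglyMeasurable[ℱ (k + 1)] (w (k + 1)))
    (hrec : ∀ k ω i, X (k + 1) ω i =
      (∑ j, W i j • X k ω j) - α • gradf i (X k ω i) - α • w (k + 1) ω i)
    -- the gradient noise: conditionally centered with conditional variance ≤ σ²N
    (hwmean : ∀ k, P[w (k + 1)|ℱ k] =ᵐ[P] 0)
    (hwL2 : ∀ k, Integrable (fun ω => ‖w (k + 1) ω‖ ^ 2) P)
    (hwvar : ∀ k, ∀ᵐ ω ∂P, (P[fun ω' => ‖w (k + 1) ω'‖ ^ 2|ℱ k]) ω ≤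
      σ ^ 2 * N + η ^ 2 / 2 * ‖X k ω - xstarN‖ ^ 2) :
    ∀ k : ℕ,
      ∫ ω, ‖X k ω - xstarN‖ ^ 2 ∂P ≤
        2 * (1 - α * μ / 2) ^ k * ‖x0 - xinf‖ ^ 2 +
          4 * α / μ * (σ ^ 2 + η ^ 2 * α ^ 2 * C₁ ^ 2 / (1 - γ) ^ 2) * N +
          2 * α ^ 2 * C₁ ^ 2 * N / (1 - γ) ^ 2 := by
  have hL : 0 < L := hμ.trans_le hμL
  have hαL : α * (L + η ^ 2 / μ) ≤ 1 / 2 + lamN := (le_div_iff₀ (by positivity)).1 hαle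
  have hlam1 : ∀ i, lam i ≤ 1 := fun i => hlamTop ▸ hlamAnti (Fin.mk_le_mk.2 (Nat.zero_le _))
  have hlamN_le : ∀ i, lamN ≤ lam i := fun i => by
    rw [hlamN]
    exact hlamAnti (Fin.mk_le_mk.2 (Nat.le_sub_one_of_lt i.2))
  have hlamN1 : lamN ≤ 1 := (hlamN_le ⟨0, hN⟩).trans (hlam1 _)
  have hLnn : ((Real.toNNReal L : ℝ≥0) : ℝ) = L := Real.coe_toNNReal L hL.le
  have hfconv : ∀ i, ConvexOn ℝ Set.univ (f i) := fun i => by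
    have hq : ConvexOn ℝ Set.univ fun x : EuclideanSpace ℝ (Fin d) => μ / 2 * ‖x‖ ^ 2 := by
      simpa using ((convexOn_univ_norm (E := EuclideanSpace ℝ (Fin d))).pow
        (fun x _ => norm_nonneg x) 2).smul (show 0 ≤ μ / 2 by positivity)
    exact ((hconv i).add hq).congr fun x _ => by simp
  let T : PiLp 2 (fun _ : Fin N => EuclideanSpace ℝ (Fin d)) →
      PiLp 2 (fun _ : Fin N => EuclideanSpace ℝ (Fin d)) :=
    fun x => WithLp.toLp 2 fun i => (∑ j, W i j • x j) - α • gradf i (x i)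
  have hTcont : Continuous T := by
    have : ∀ i, Continuous (gradf i) := fun i => (hlip i).continuous
    fun_prop
  have hTcontr : ∀ x, ‖T x - xinf‖ ^ 2 ≤ (1 - α * μ / 2 - α ^ 2 * η ^ 2) * ‖x - xinf‖ ^ 2 :=
      fun x => by
    let u : PiLp 2 (fun _ : Fin N => EuclideanSpace ℝ (Fin d)) :=
      WithLp.toLp 2 fun i => (x - xinf) i - ∑ j, W i j • (x - xinf) j
    let h : PiLp 2 (fun _ : Fin N => EuclideanSpace ℝ (Fin d)) :=
      WithLp.toLp 2 fun i => α • (gradf i (x i) - gradf i (xinf i))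
    have hT : T x - xinf = (x - xinf) - (u + h) := by
      ext1 i
      have hi : (∑ j, W i j • xinf j) - α • gradf i (xinf i) = xinf i := by
        rw [← sub_eq_zero, ← neg_eq_zero, ← hxinf i]
        abel
      simp only [T, u, h, PiLp.sub_apply, PiLp.add_apply, smul_sub, Finset.sum_sub_distrib]
      nth_rewrite 1 [← hi]
      abel
    have hu := Matrix.inner_nonneg_and_norm_sq_le_of_eq_transpose_mul_diagonal_mul hV hWeig hlam1
      (fun i => sub_le_sub_left (hlamN_le i) 1) (u := u) (e := x - xinf) fun i => rfl
    have hhe : α * μ * ‖x - xinf‖ ^ 2 ≤ ⟪h, x - xinf⟫ := by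
      rw [PiLp.inner_apply, PiLp.norm_sq_eq_of_L2, Finset.mul_sum]
      refine Finset.sum_le_sum fun i _ => ?_
      simp only [h, PiLp.sub_apply, inner_smul_left, conj_trivial, mul_assoc]
      exact mul_le_mul_of_nonneg_left
        (mul_norm_sub_sq_le_inner_of_strongly_convex (hconv i) (hgrad i) _ _) hα0.le
    have hh : ‖h‖ ^ 2 ≤ α * L * ⟪h, x - xinf⟫ := by
      rw [PiLp.inner_apply, PiLp.norm_sq_eq_of_L2, Finset.mul_sum]
      refine Finset.sum_le_sum fun i _ => ?_
      have := (hlip i).norm_sub_sq_le_mul_inner_of_hasGradientAt (Real.toNNReal_pos.2 hL)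
        (hgrad i) (hfconv i) (x i) (xinf i)
      rw [hLnn] at this
      simp only [h, PiLp.sub_apply, inner_smul_left, conj_trivial, norm_smul, mul_pow,
        Real.norm_eq_abs, sq_abs]
      calc _ ≤ α ^ 2 * (L * ⟪gradf i (x i) - gradf i (xinf i), x i - xinf i⟫) := by gcongr
        _ = _ := by ring
    have hh0 : 0 ≤ ⟪h, x - xinf⟫ := le_trans (by positivity) hhe
    have hsum := norm_add_sq_le_mul_inner_add (sub_nonneg.2 hlamN1) (by positivity) hu.1 hh0
      hu.2 hh
    have hsumμ : α * μ * ‖x - xinf‖ ^ 2 ≤ ⟪u + h, x - xinf⟫ := by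
      rw [inner_add_left]
      linarith [hu.1]
    rw [hT]
    refine (norm_sub_sq_le_of_norm_sq_le_mul_inner (b := 1 / 2 + α * (η ^ 2 / μ))
      (by positivity) (by linarith) (by positivity) hsum hsumμ).trans_eq ?_
    field_simp
    ring
  have hTle : ∀ x, ‖T x - xinf‖ ≤ ‖x - xinf‖ := fun x => by
    refine le_of_sq_le_sq ((hTcontr x).trans ?_) (norm_nonneg _)
    have : 0 ≤ α * μ / 2 + α ^ 2 * η ^ 2 := by positivity
    nlinarith [sq_nonneg ‖x - xinf‖]
  have hstep : ∀ k ω, X (k + 1) ω - xinf = (T (X k ω) - xinf) - α • w (k + 1) ω := fun k ω => by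
    ext1 i
    simp only [T, PiLp.sub_apply, PiLp.smul_apply, hrec]
    abel
  have hTmeas : ∀ k, StronglyMeasurable[ℱ k] fun ω => T (X k ω) - xinf := fun k =>
    (hTcont.comp_stronglyMeasurable (hXadapted k)).sub stronglyMeasurable_const
  have hwLp : ∀ k, MemLp (w (k + 1)) 2 P := fun k =>
    (memLp_two_iff_integrable_sq_norm ((hwmeas k).mono (hℱ _)).aestronglyMeasurable).2 (hwL2 k)
  have hTLp : ∀ k, MemLp (fun ω => X k ω - xinf) 2 P →
      MemLp (fun ω => T (X k ω) - xinf) 2 P := fun k hk =>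
    hk.of_le ((hTmeas k).mono (hℱ k)).aestronglyMeasurable (ae_of_all _ fun ω => hTle _)
  have hXLp : ∀ k, MemLp (fun ω => X k ω - xinf) 2 P := fun k => by
    induction k with
    | zero => simpa only [hX0] using memLp_const (x0 - xinf)
    | succ k ih =>
      simp only [hstep]
      exact (hTLp k ih).sub ((hwLp k).const_smul α)
  have hXsq : ∀ k, Integrable (fun ω => ‖X k ω - xinf‖ ^ 2) P := fun k =>
    (hXLp k).integrable_norm_pow two_ne_zero
  have hXstarLp : ∀ k, MemLp (fun ω => X k ω - xstarN) 2 P := fun k => by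
    simpa [Pi.add_def] using (hXLp k).add (memLp_const (xinf - xstarN))
  have hXstarsq : ∀ k, Integrable (fun ω => ‖X k ω - xstarN‖ ^ 2) P := fun k =>
    (hXstarLp k).integrable_norm_pow two_ne_zero
  have hXstar_le : ∀ k, ∫ ω, ‖X k ω - xstarN‖ ^ 2 ∂P
      ≤ 2 * ∫ ω, ‖X k ω - xinf‖ ^ 2 ∂P + 2 * ‖xinf - xstarN‖ ^ 2 := fun k => by
    refine (integral_mono (hXstarsq k) (((hXsq k).const_mul 2).add (integrable_const _))
      fun ω => norm_sub_sq_le_two_mul_add (X k ω) xinf xstarN).trans_eq ?_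
    rw [integral_add' ((hXsq k).const_mul 2) (integrable_const _), integral_const_mul]
    simp
  have hwint : ∀ k, ∫ ω, ‖w (k + 1) ω‖ ^ 2 ∂P
      ≤ σ ^ 2 * N + η ^ 2 / 2 * ∫ ω, ‖X k ω - xstarN‖ ^ 2 ∂P := fun k => by
    rw [← integral_condExp (hℱ k)]
    refine (integral_mono_ae integrable_condExp
      ((integrable_const _).add ((hXstarsq k).const_mul _)) (hwvar k)).trans_eq ?_
    rw [integral_add' (integrable_const _) ((hXstarsq k).const_mul _), integral_const,
      integral_const_mul]
    simp
  have hrecE : ∀ k, ∫ ω, ‖X (k + 1) ω - xinf‖ ^ 2 ∂P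
      ≤ (1 - α * μ / 2) * ∫ ω, ‖X k ω - xinf‖ ^ 2 ∂P
        + α ^ 2 * (σ ^ 2 * N + η ^ 2 * ‖xinf - xstarN‖ ^ 2) := fun k => by
    have h1 : ∫ ω, ‖T (X k ω) - xinf‖ ^ 2 ∂P
        ≤ (1 - α * μ / 2 - α ^ 2 * η ^ 2) * ∫ ω, ‖X k ω - xinf‖ ^ 2 ∂P := by
      rw [← integral_const_mul]
      exact integral_mono ((hTLp k (hXLp k)).integrable_norm_pow two_ne_zero)
        ((hXsq k).const_mul _) fun ω => hTcontr _
    have h2 := (hwint k).trans (add_le_add_right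
      (mul_le_mul_of_nonneg_left (hXstar_le k) (show 0 ≤ η ^ 2 / 2 by positivity)) _)
    simp only [hstep]
    rw [integral_norm_sub_smul_sq_of_condExp_eq_zero (hℱ k) (hTmeas k) (hTLp k (hXLp k)) (hwLp k)
      (hwmean k)]
    linarith [mul_le_mul_of_nonneg_left h2 (sq_nonneg α)]
  have hαμ : α * μ ≤ 3 / 2 := by
    have := mul_le_mul_of_nonneg_left hμL hα0.le
    have : 0 ≤ α * (η ^ 2 / μ) := by positivity
    linarith
  have hαμ0 : 0 < α * μ := by positivity
  intro k
  have hk := le_pow_mul_add_div_of_le_mul_add (a := fun k => ∫ ω, ‖X k ω - xinf‖ ^ 2 ∂P)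
    (by linarith) (by linarith) (by positivity) hrecE k
  have hE0 : ∫ ω, ‖X 0 ω - xinf‖ ^ 2 ∂P = ‖x0 - xinf‖ ^ 2 := by simp [hX0]
  rw [hE0] at hk
  have hD : ‖xinf - xstarN‖ ^ 2 ≤ α ^ 2 * C₁ ^ 2 * N / (1 - γ) ^ 2 := by
    refine (pow_le_pow_left₀ (norm_nonneg _) hxinfstar 2).trans_eq ?_
    rw [div_pow, mul_pow, mul_pow, Real.sq_sqrt (Nat.cast_nonneg N)]
  have hc : α ^ 2 * (σ ^ 2 * N + η ^ 2 * ‖xinf - xstarN‖ ^ 2) / (1 - (1 - α * μ / 2))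
      ≤ 2 * α / μ * (σ ^ 2 * N + η ^ 2 * (α ^ 2 * C₁ ^ 2 * N / (1 - γ) ^ 2)) := by
    calc _ = 2 * α / μ * (σ ^ 2 * N + η ^ 2 * ‖xinf - xstarN‖ ^ 2) := by
          rw [sub_sub_cancel]
          field_simp
      _ ≤ _ := by gcongr
  calc _ ≤ 2 * ((1 - α * μ / 2) ^ k * ‖x0 - xinf‖ ^ 2
          + 2 * α / μ * (σ ^ 2 * N + η ^ 2 * (α ^ 2 * C₁ ^ 2 * N / (1 - γ) ^ 2)))
          + 2 * (α ^ 2 * C₁ ^ 2 * N / (1 - γ) ^ 2) := by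
        linarith [hXstar_le k]
    _ = _ := by ring
end
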